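/- Assume the hyperbolic periodic orbit setup. Let k ≥ 1 and let (B_t)_{t ∈ ℝ} be a continuous T-periodic family of k-multilinear maps (ℝ^n)^k → ℝ, and suppose the equation (d/dt)A_t(v_1,…,v_k) + Σ_{j=1}^{k} A_t(v_1,…,F^(1)_{x(t)}(v_j),…,v_k) = B_t(v_1,…,v_k) admits at least one T-periodic solution. Fix a k-multilinear map A, and for each positive integer N let (A_{t,N})_{0 ≤ t ≤ NT} be the solution of this equation with terminal condition A_{NT,N} = A. Then there exist a T-periodic solution (A_t)_{t ∈ ℝ} of the equation, independent of N, and constants K > 0 and 0 < μ < 1 such that sup_{0 ≤ t ≤ T} ‖A_{t,N} − A_t‖ ≤ K μ^N for all N. -/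

import Mathlib

open scoped BigOperators

section Flow

open Set

variable {E : Type*} [NormedAddCommGroup E] [NormedSpace ℝ E]
  {F : E → E} {φ : ℝ → E → E}

/-- The flow of a `C¹` vector field satisfies the group law. -/
theorem flow_add (hF : ContDiff ℝ 1 F) (hφ0 : ∀ y, φ 0 y = y)
    (hφflow : ∀ t y, HasDerivAt (fun s => φ s y) (F (φ t y)) t) (s t : ℝ) (y : E) :
    φ (s + t) y = φ s (φ t y) := by
  have hf : ∀ r, HasDerivAt (fun r => φ (r + t) y) (F (φ (r + t) y)) r := fun r =>
    (hφflow (r + t) y).comp_add_const r t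
  have hg : ∀ r, HasDerivAt (fun r => φ r (φ t y)) (F (φ r (φ t y))) r := fun r =>
    hφflow r (φ t y)
  have hfc : Continuous fun r => φ (r + t) y :=
    continuous_iff_continuousAt.2 fun r => (hf r).continuousAt
  have hgc : Continuous fun r => φ r (φ t y) :=
    continuous_iff_continuousAt.2 fun r => (hg r).continuousAt
  have hI : IsCompact (Icc (-|s| - 1) (|s| + 1)) := isCompact_Icc
  obtain ⟨K, hK⟩ := (hF.locallyLipschitz.locallyLipschitzOn
    (s := (fun r => φ (r + t) y) '' Icc (-|s| - 1) (|s| + 1) ∪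
      (fun r => φ r (φ t y)) '' Icc (-|s| - 1) (|s| + 1))).exists_lipschitzOnWith_of_compact
    ((hI.image hfc).union (hI.image hgc))
  have hs := abs_nonneg s
  refine ODE_solution_unique_of_mem_Icc (v := fun _ => F) (fun _ _ => hK) (t₀ := 0)
    ⟨by linarith, by linarith⟩ hfc.continuousOn (fun r _ => hf r)
    (fun r hr => Or.inl ⟨r, Ioo_subset_Icc_self hr, rfl⟩) hgc.continuousOn (fun r _ => hg r)
    (fun r hr => Or.inr ⟨r, Ioo_subset_Icc_self hr, rfl⟩) (by simp [hφ0])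
    ⟨by linarith [neg_abs_le s], by linarith [le_abs_self s]⟩

theorem differentiable_flow (hφ : ContDiff ℝ 2 fun p : ℝ × E => φ p.1 p.2) (t : ℝ) :
    Differentiable ℝ (φ t) :=
  (hφ.differentiable (by norm_num)).comp ((differentiable_const t).prodMk differentiable_id)

theorem fderiv_flow_apply (hφ : ContDiff ℝ 2 fun p : ℝ × E => φ p.1 p.2) (t : ℝ) (y : E) :
    fderiv ℝ (φ t) y =
      (fderiv ℝ (fun p : ℝ × E => φ p.1 p.2) (t, y)).comp (ContinuousLinearMap.inr ℝ ℝ E) :=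
  ((hφ.differentiable (by norm_num) (t, y)).hasFDerivAt.comp y (hasFDerivAt_prodMk_right t y)).fderiv

/-- The first variational equation along a trajectory of a flow. -/
theorem hasDerivAt_fderiv_flow (hF : ContDiff ℝ 1 F)
    (hφ : ContDiff ℝ 2 fun p : ℝ × E => φ p.1 p.2)
    (hφflow : ∀ t y, HasDerivAt (fun s => φ s y) (F (φ t y)) t) (t : ℝ) (y u : E) :
    HasDerivAt (fun s => fderiv ℝ (φ s) y u)
      (fderiv ℝ F (φ t y) (fderiv ℝ (φ t) y u)) t := by
  set Ψ : ℝ × E → E := fun p => φ p.1 p.2 with hΨ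
  have hD : ∀ p, HasFDerivAt Ψ (fderiv ℝ Ψ p) p := fun p =>
    (hφ.differentiable (by norm_num) p).hasFDerivAt
  have hDD : HasFDerivAt (fderiv ℝ Ψ) (fderiv ℝ (fderiv ℝ Ψ) (t, y)) (t, y) :=
    ((hφ.fderiv_right (m := 1) (by norm_num)).differentiable (by norm_num) (t, y)).hasFDerivAt
  have htime : ∀ p, fderiv ℝ Ψ p (1, 0) = F (Ψ p) := fun p => by
    have h1 : HasDerivAt (fun s => Ψ (s, p.2)) (fderiv ℝ Ψ p (1, 0)) p.1 :=
      (hD (p.1, p.2)).comp_hasDerivAt (f := fun s => (s, p.2)) p.1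
        ((hasDerivAt_id p.1).prodMk (hasDerivAt_const p.1 p.2))
    exact h1.unique (hφflow p.1 p.2)
  have hsymm : fderiv ℝ (fderiv ℝ Ψ) (t, y) (1, 0) (0, u) =
      fderiv ℝ (fderiv ℝ Ψ) (t, y) (0, u) (1, 0) :=
    (hφ.contDiffAt.isSymmSndFDerivAt (by simp)) _ _
  have hmixed : fderiv ℝ (fderiv ℝ Ψ) (t, y) (0, u) (1, 0) =
      fderiv ℝ F (φ t y) (fderiv ℝ (φ t) y u) := by
    have h1 : HasFDerivAt (fun p => fderiv ℝ Ψ p (1, 0)) _ (t, y) :=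
      hDD.clm_apply (hasFDerivAt_const (1, 0) (t, y))
    have h2 : HasFDerivAt (fun p => F (Ψ p)) _ (t, y) :=
      ((hF.differentiable (by norm_num) (Ψ (t, y))).hasFDerivAt).comp (t, y) (hD (t, y))
    rw [funext htime] at h1
    have h3 := DFunLike.congr_fun (h1.unique h2) (0, u)
    simpa [fderiv_flow_apply hφ] using h3
  have h4 : HasDerivAt (fun s => fderiv ℝ Ψ (s, y)) (fderiv ℝ (fderiv ℝ Ψ) (t, y) (1, 0)) t :=
    hDD.comp_hasDerivAt t ((hasDerivAt_id t).prodMk (hasDerivAt_const t y))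
  have h5 := h4.clm_apply (hasDerivAt_const t ((0, u) : ℝ × E))
  simpa [fderiv_flow_apply hφ, hsymm, hmixed] using h5

theorem continuous_fderiv_flow (hφ : ContDiff ℝ 2 fun p : ℝ × E => φ p.1 p.2) :
    Continuous fun p : ℝ × E => fderiv ℝ (φ p.1) p.2 := by
  simp_rw [fderiv_flow_apply hφ]
  exact ((hφ.continuous_fderiv (by norm_num)).comp continuous_id).clm_comp continuous_const

/-- The flow maps the vector field to itself. -/
theorem fderiv_flow_vectorField (hF : ContDiff ℝ 1 F) (hφ0 : ∀ y, φ 0 y = y)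
    (hφ : ContDiff ℝ 2 fun p : ℝ × E => φ p.1 p.2)
    (hφflow : ∀ t y, HasDerivAt (fun s => φ s y) (F (φ t y)) t) (t : ℝ) (y : E) :
    fderiv ℝ (φ t) y (F y) = F (φ t y) := by
  have h0 := hφflow 0 y
  rw [hφ0] at h0
  have h1 : HasDerivAt (fun s => φ t (φ s y)) (fderiv ℝ (φ t) y (F y)) 0 := by
    have := (differentiable_flow hφ t (φ 0 y)).hasFDerivAt.comp_hasDerivAt 0 h0
    rwa [hφ0] at this
  have h2 : HasDerivAt (fun s => φ (s + t) y) (F (φ (0 + t) y)) 0 :=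
    (hφflow (0 + t) y).comp_add_const 0 t
  simp_rw [add_comm _ t, flow_add hF hφ0 hφflow t _ y, hφ0] at h2
  exact h1.unique h2

/-- The derivative of `φ t` at `y` is inverted by the derivative of `φ (-t)` at `φ t y`. -/
theorem fderiv_flow_fderiv_flow_neg (hF : ContDiff ℝ 1 F) (hφ0 : ∀ y, φ 0 y = y)
    (hφ : ContDiff ℝ 2 fun p : ℝ × E => φ p.1 p.2)
    (hφflow : ∀ t y, HasDerivAt (fun s => φ s y) (F (φ t y)) t) (t : ℝ) (y v : E) :
    fderiv ℝ (φ t) y (fderiv ℝ (φ (-t)) (φ t y) v) = v := by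
  have hinv : φ (-t) (φ t y) = y := by
    rw [← flow_add hF hφ0 hφflow, neg_add_cancel, hφ0]
  have h1 := (differentiable_flow hφ t (φ (-t) (φ t y))).hasFDerivAt.comp (φ t y)
    (differentiable_flow hφ (-t) (φ t y)).hasFDerivAt
  have h2 : φ t ∘ φ (-t) = id := funext fun z => by
    rw [Function.comp_apply, ← flow_add hF hφ0 hφflow, add_neg_cancel, hφ0, id]
  rw [h2, hinv] at h1
  exact DFunLike.congr_fun (h1.unique (hasFDerivAt_id _)) v

theorem flow_natCast_mul_period (hF : ContDiff ℝ 1 F) (hφ0 : ∀ y, φ 0 y = y)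
    (hφflow : ∀ t y, HasDerivAt (fun s => φ s y) (F (φ t y)) t) {T : ℝ} {x : E}
    (hper : φ T x = x) (N : ℕ) : φ (N * T) x = x := by
  induction N with
  | zero => simp [hφ0]
  | succ N ih => rw [Nat.cast_succ, add_one_mul, flow_add hF hφ0 hφflow, hper, ih]

end Flow

section Multilinear

open Set

variable {E : Type*} [NormedAddCommGroup E] [NormedSpace ℝ E] {k : ℕ}

/-- A family of multilinear maps on a finite-dimensional space that is differentiable pointwise is
differentiable in the operator norm. -/
theorem exists_hasDerivWithinAt_of_apply [FiniteDimensional ℝ E] {S : Set ℝ} {t : ℝ}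
    (hS : UniqueDiffWithinAt ℝ S t)
    {A : ℝ → ContinuousMultilinearMap ℝ (fun _ : Fin k => E) ℝ} {r : (Fin k → E) → ℝ}
    (h : ∀ v, HasDerivWithinAt (fun s => A s v) (r v) S t) :
    ∃ A' : ContinuousMultilinearMap ℝ (fun _ : Fin k => E) ℝ,
      HasDerivWithinAt A A' S t ∧ ∀ v, A' v = r v := by
  let b := Module.finBasis ℝ E
  let θ : (Fin k → Fin (Module.finrank ℝ E)) →
      ContinuousMultilinearMap ℝ (fun _ : Fin k => E) ℝ := fun J =>
    (ContinuousMultilinearMap.mkPiAlgebra ℝ (Fin k) ℝ).compContinuousLinearMap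
      fun i => LinearMap.toContinuousLinearMap (b.coord (J i))
  have hA : A = fun s => ∑ J, A s (fun i => b (J i)) • θ J := by
    funext s
    ext v
    have hv : v = fun i => ∑ j, b.repr (v i) j • b j := funext fun i => (b.sum_repr (v i)).symm
    conv_lhs => rw [hv, ContinuousMultilinearMap.map_sum]
    rw [sum_apply]
    refine Finset.sum_congr rfl fun J _ => ?_
    rw [ContinuousMultilinearMap.map_smul_univ]
    simp [θ, mul_comm]
  have hd : HasDerivWithinAt A (∑ J, r (fun i => b (J i)) • θ J) S t := by
    rw [hA]
    exact HasDerivWithinAt.fun_sum fun J _ => (h _).smul_const (θ J)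
  refine ⟨_, hd, fun v => hS.eq_deriv _ ?_ (h v)⟩
  exact ((ContinuousMultilinearMap.apply ℝ (fun _ : Fin k => E) ℝ v).hasFDerivAt
    ).comp_hasDerivWithinAt t hd

/-- A solution of the homogeneous tensor equation is constant along solutions of the
variational equation. -/
theorem apply_eq_of_homogeneous [FiniteDimensional ℝ E] {a b : ℝ} (hab : a < b)
    {L : ℝ → E →L[ℝ] E}
    {Z : ℝ → ContinuousMultilinearMap ℝ (fun _ : Fin k => E) ℝ}
    (hZ : ∀ t ∈ Icc a b, ∀ v : Fin k → E, HasDerivWithinAt (fun s => Z s v)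
      (-∑ j, Z t (Function.update v j (L t (v j)))) (Icc a b) t)
    {m : Fin k → ℝ → E} (hm : ∀ i t, HasDerivAt (m i) (L t (m i t)) t) :
    ∀ t ∈ Icc a b, Z t (fun i => m i t) = Z a (fun i => m i a) := by
  have key : ∀ t ∈ Icc a b, HasDerivWithinAt (fun s => Z s (fun i => m i s)) 0 (Icc a b) t := by
    intro t ht
    obtain ⟨Z', hZ', hZ'v⟩ := exists_hasDerivWithinAt_of_apply (uniqueDiffOn_Icc hab t ht) (hZ t ht)
    have h := (hZ'.hasFDerivWithinAt.continuousMultilinearMap_apply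
      fun i => (hm i t).hasFDerivAt.hasFDerivWithinAt).hasDerivWithinAt
    convert! h using 1
    simp [hZ'v]
  exact constant_of_has_deriv_right_zero (fun t ht => (key t ht).continuousWithinAt) fun t ht =>
    (key t (Ico_subset_Icc_self ht)).mono_of_mem_nhdsWithin (Icc_mem_nhdsGE_of_mem ht)

/-- Multiples of tensor powers of a solution of the adjoint equation solve the homogeneous
tensor equation. -/
theorem hasDerivAt_smul_prod_apply {L : ℝ → E →L[ℝ] E} {Q : ℝ → E →L[ℝ] ℝ}
    (hQ : ∀ t v, HasDerivAt (fun s => Q s v) (-(Q t (L t v))) t) (c t : ℝ) (v : Fin k → E) :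
    HasDerivAt (fun s => c * ∏ i, Q s (v i))
      (-∑ j, c * ∏ i, Q t (Function.update v j (L t (v j)) i)) t := by
  convert! (HasDerivAt.fun_finsetProd (u := Finset.univ) fun i _ => hQ t (v i)).const_mul c using 1
  rw [Finset.mul_sum, ← Finset.sum_neg_distrib]
  refine Finset.sum_congr rfl fun j _ => ?_
  rw [← Finset.mul_prod_erase _ _ (Finset.mem_univ j), Function.update_self,
    Finset.prod_congr rfl fun i hi => by rw [Function.update_of_ne (Finset.ne_of_mem_erase hi)]]
  simp only [smul_eq_mul]
  ring

/-- If `G` vanishes at `a`, its value at a nearby point is small. -/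
theorem norm_apply_le_of_apply_eq_zero (G : ContinuousMultilinearMap ℝ (fun _ : Fin k => E) ℝ)
    {m a : Fin k → E} {c : Fin k → ℝ} {R q : ℝ} (hG : G a = 0)
    (hm : ∀ i, ‖m i‖ ≤ R * c i) (ha : ∀ i, ‖a i‖ ≤ R * c i)
    (hma : ∀ i, ‖m i - a i‖ ≤ q * (R * c i)) :
    ‖G m‖ ≤ ‖G‖ * k * R ^ k * q * ∏ i, c i := by
  have h := G.norm_image_sub_le' m a
  rw [hG, sub_zero] at h
  have hterm : ∀ i : Fin k, (∏ j, if j = i then ‖m i - a i‖ else max ‖m j‖ ‖a j‖) ≤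
      q * ∏ j, R * c j := by
    intro i
    rw [← Finset.mul_prod_erase _ _ (Finset.mem_univ i),
      ← Finset.mul_prod_erase _ (fun j => R * c j) (Finset.mem_univ i), ← mul_assoc, if_pos rfl]
    refine mul_le_mul (hma i) ?_ ?_ ((norm_nonneg _).trans (hma i))
    · refine Finset.prod_le_prod (fun j _ => by split_ifs <;> positivity) fun j hj => ?_
      rw [if_neg (Finset.ne_of_mem_erase hj)]
      exact max_le (hm j) (ha j)
    · exact Finset.prod_nonneg fun j _ => by split_ifs <;> positivity
  calc ‖G m‖ ≤ ‖G‖ * ∑ _i : Fin k, q * ∏ j, R * c j :=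
        h.trans (by gcongr with i; exact hterm i)
    _ = ‖G‖ * k * R ^ k * q * ∏ i, c i := by
        simp [Finset.prod_mul_distrib]
        ring

/-- Let `Φ` fix `e` and contract the range of `p` by a factor `q`, where `p` is a projection along
`e`. If `G` vanishes on `e`, then the pullback of `G` by `Φ` is of order `q`. -/
theorem norm_apply_le_of_contracting (G : ContinuousMultilinearMap ℝ (fun _ : Fin k => E) ℝ)
    {e : E} (hG : G (fun _ => e) = 0) {p Φ : E →L[ℝ] E} (hp : ∀ u, ∃ a : ℝ, a • e = u - p u)
    (hfix : Φ e = e) {C q M : ℝ} (hC : 0 ≤ C) (hq0 : 0 ≤ q) (hq1 : q ≤ 1)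
    (hcontr : ∀ u, ‖Φ (p u)‖ ≤ C * q * ‖p u‖) (hM : 0 ≤ M) {u v : Fin k → E}
    (huv : ∀ i, ‖u i‖ ≤ M * ‖v i‖) :
    ‖G fun i => Φ (u i)‖ ≤
      ‖G‖ * k * ((1 + ‖p‖ + C * ‖p‖) * M) ^ k * q * ∏ i, ‖v i‖ := by
  choose a ha using fun i => hp (u i)
  have hGa : G (fun i => a i • e) = 0 := by
    rw [ContinuousMultilinearMap.map_smul_univ, hG, smul_zero]
  have hsub : ∀ i, Φ (u i) - a i • e = Φ (p (u i)) := fun i => by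
    have h : Φ (a i • e) = Φ (u i - p (u i)) := congrArg Φ (ha i)
    rw [map_smul, hfix, map_sub] at h
    rw [h, sub_sub_cancel]
  have hstable : ∀ i, ‖Φ (u i) - a i • e‖ ≤ q * (C * ‖p‖ * M * ‖v i‖) := fun i => by
    rw [hsub]
    calc ‖Φ (p (u i))‖ ≤ C * q * ‖p (u i)‖ := hcontr _
      _ ≤ C * q * (‖p‖ * (M * ‖v i‖)) := by
        gcongr
        exact (p.le_opNorm _).trans (by gcongr; exact huv i)
      _ = q * (C * ‖p‖ * M * ‖v i‖) := by ring
  have hcentral : ∀ i, ‖a i • e‖ ≤ (1 + ‖p‖) * M * ‖v i‖ := fun i => by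
    rw [ha]
    calc ‖u i - p (u i)‖ ≤ ‖u i‖ + ‖p‖ * ‖u i‖ :=
          (norm_sub_le _ _).trans (by gcongr; exact p.le_opNorm _)
      _ = (1 + ‖p‖) * ‖u i‖ := by ring
      _ ≤ (1 + ‖p‖) * (M * ‖v i‖) := by gcongr; exact huv i
      _ = (1 + ‖p‖) * M * ‖v i‖ := by ring
  have hC' : ∀ i, 0 ≤ C * ‖p‖ * M * ‖v i‖ := fun i => by positivity
  have hp' : ∀ i, 0 ≤ (1 + ‖p‖) * M * ‖v i‖ := fun i => by positivity
  have hsplit : ∀ i, (1 + ‖p‖ + C * ‖p‖) * M * ‖v i‖ =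
      (1 + ‖p‖) * M * ‖v i‖ + C * ‖p‖ * M * ‖v i‖ := fun i => by ring
  refine norm_apply_le_of_apply_eq_zero G hGa (fun i => ?_) (fun i => ?_) fun i => ?_
  · rw [hsplit]
    exact (norm_le_norm_add_norm_sub' _ _).trans (add_le_add (hcentral i)
      ((hstable i).trans (mul_le_of_le_one_left (hC' i) hq1)))
  · linarith [hsplit i, hcentral i, hC' i]
  · refine (hstable i).trans (mul_le_mul_of_nonneg_left ?_ hq0)
    linarith [hsplit i, hp' i]

end Multilinear




/-- Backward-integration convergence (part 2 of the main theorem): the solutions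
`A_{t,N}` of the non-homogeneous variational tensor equation on `[0, NT]` with an
arbitrary fixed terminal condition `A_{NT,N} = A` converge exponentially, uniformly on
`[0, T]`, to a `T`-periodic solution as `N → ∞`. -/
theorem stmt_10 {n : ℕ}
    (F : EuclideanSpace ℝ (Fin n) → EuclideanSpace ℝ (Fin n)) (hF : ContDiff ℝ (⊤ : ℕ∞) F)
    (φ : ℝ → EuclideanSpace ℝ (Fin n) → EuclideanSpace ℝ (Fin n))
    (hφ0 : ∀ y, φ 0 y = y)
    (hφsmooth : ContDiff ℝ (⊤ : ℕ∞) fun p : ℝ × EuclideanSpace ℝ (Fin n) => φ p.1 p.2)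
    (hφflow : ∀ t y, HasDerivAt (fun s => φ s y) (F (φ t y)) t)
    (hφbij : ∀ t, Function.Bijective (φ t))
    (x : EuclideanSpace ℝ (Fin n)) (T : ℝ) (hT : 0 < T)
    (hper : φ T x = x) (hFx : F x ≠ 0)
    (W : ℝ → Submodule ℝ (EuclideanSpace ℝ (Fin n)))
    (hWcompl : ∀ t, IsCompl (Submodule.span ℝ {F (φ t x)}) (W t))
    (hWinv : ∀ s t, Submodule.map (fderiv ℝ (φ s) (φ t x) : _ →ₗ[ℝ] _) (W t) = W (t + s))
    (hWper : ∀ t, W (t + T) = W t)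
    (C lam : ℝ) (hC : 0 < C) (hlam0 : 0 < lam) (hlam1 : lam < 1)
    (hcontr : ∀ t : ℝ, ∀ s : ℝ, 0 ≤ s → ∀ v ∈ W t,
      ‖fderiv ℝ (φ s) (φ t x) v‖ ≤ C * lam ^ s * ‖v‖)
    (Q1 : ℝ → (EuclideanSpace ℝ (Fin n) →L[ℝ] ℝ))
    (hQ1per : ∀ t, Q1 (t + T) = Q1 t)
    (hQ1ode : ∀ (t : ℝ) (v : EuclideanSpace ℝ (Fin n)),
      HasDerivAt (fun s => Q1 s v) (-(Q1 t (fderiv ℝ F (φ t x) v))) t)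
    (hQ1norm : ∀ t, Q1 t (F (φ t x)) = 1 / T)
    (k : ℕ) (hk : 1 ≤ k)
    (B : ℝ → ContinuousMultilinearMap ℝ (fun _ : Fin k => EuclideanSpace ℝ (Fin n)) ℝ)
    (hBcont : Continuous B) (hBper : ∀ t, B (t + T) = B t)
    (hexists : ∃ P : ℝ → ContinuousMultilinearMap ℝ
        (fun _ : Fin k => EuclideanSpace ℝ (Fin n)) ℝ,
      (∀ t, P (t + T) = P t) ∧
        ∀ (t : ℝ) (v : Fin k → EuclideanSpace ℝ (Fin n)),
          HasDerivAt (fun s => P s v)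
            (B t v - ∑ j : Fin k, P t (Function.update v j (fderiv ℝ F (φ t x) (v j)))) t)
    (A0 : ContinuousMultilinearMap ℝ (fun _ : Fin k => EuclideanSpace ℝ (Fin n)) ℝ)
    (AN : ℕ → ℝ → ContinuousMultilinearMap ℝ (fun _ : Fin k => EuclideanSpace ℝ (Fin n)) ℝ)
    (hANterm : ∀ N : ℕ, 1 ≤ N → AN N ((N : ℝ) * T) = A0)
    (hANode : ∀ N : ℕ, 1 ≤ N → ∀ t ∈ Set.Icc (0 : ℝ) ((N : ℝ) * T),
      ∀ v : Fin k → EuclideanSpace ℝ (Fin n),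
        HasDerivWithinAt (fun s => AN N s v)
          (B t v - ∑ j : Fin k, AN N t (Function.update v j (fderiv ℝ F (φ t x) (v j))))
          (Set.Icc (0 : ℝ) ((N : ℝ) * T)) t) :
    ∃ A : ℝ → ContinuousMultilinearMap ℝ (fun _ : Fin k => EuclideanSpace ℝ (Fin n)) ℝ,
      (∀ t, A (t + T) = A t) ∧
      (∀ (t : ℝ) (v : Fin k → EuclideanSpace ℝ (Fin n)),
        HasDerivAt (fun s => A s v)
          (B t v - ∑ j : Fin k, A t (Function.update v j (fderiv ℝ F (φ t x) (v j)))) t) ∧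
      ∃ K μ : ℝ, 0 < K ∧ 0 < μ ∧ μ < 1 ∧
        ∀ N : ℕ, 1 ≤ N → ∀ t ∈ Set.Icc (0 : ℝ) T, ‖AN N t - A t‖ ≤ K * μ ^ N := by
  have hF1 : ContDiff ℝ 1 F := hF.of_le (by exact_mod_cast le_top)
  have hφ2 : ContDiff ℝ 2 fun p : ℝ × EuclideanSpace ℝ (Fin n) => φ p.1 p.2 :=
    hφsmooth.of_le (WithTop.coe_le_coe.2 (le_top : (2 : ℕ∞) ≤ ⊤))
  obtain ⟨P, hPper, hPode⟩ := hexists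
  have hNT : ∀ N : ℕ, φ (N * T) x = x := flow_natCast_mul_period hF1 hφ0 hφflow hper
  have hPN : ∀ N : ℕ, P (N * T) = P 0 := fun N => by
    simpa using (show Function.Periodic P T from hPper).nat_mul N 0
  have hQN : ∀ N : ℕ, Q1 (N * T) = Q1 0 := fun N => by
    simpa using (show Function.Periodic Q1 T from hQ1per).nat_mul N 0
  have hQ0 : Q1 0 (F x) = 1 / T := by simpa [hφ0] using hQ1norm 0
  set c : ℝ := T ^ k * (A0 - P 0) (fun _ => F x) with hc
  let H : ℝ → ContinuousMultilinearMap ℝ (fun _ : Fin k => EuclideanSpace ℝ (Fin n)) ℝ := fun t =>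
    c • (ContinuousMultilinearMap.mkPiAlgebra ℝ (Fin k) ℝ).compContinuousLinearMap fun _ => Q1 t
  have hHapply : ∀ t v, H t v = c * ∏ i, Q1 t (v i) := fun t v => by simp [H]
  have hHode : ∀ (t : ℝ) (v : Fin k → EuclideanSpace ℝ (Fin n)), HasDerivAt (fun s => H s v)
      (-∑ j, H t (Function.update v j (fderiv ℝ F (φ t x) (v j)))) t := fun t v => by
    simp only [hHapply]
    exact hasDerivAt_smul_prod_apply (L := fun t => fderiv ℝ F (φ t x)) hQ1ode c t v
  have hHN : ∀ N : ℕ, H (N * T) = H 0 := fun N => by simp only [H, hQN N]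
  set G := A0 - (P 0 + H 0) with hG
  have hGF : G (fun _ => F x) = 0 := by
    have : H 0 (fun _ => F x) = (A0 - P 0) (fun _ => F x) := by
      rw [hHapply, hc]
      simp [hQ0]
      field_simp
    simp [hG, this]
  -- the splitting at the base point
  have hW0 : IsCompl (W 0) (Submodule.span ℝ {F x}) := by simpa [hφ0] using (hWcompl 0).symm
  let p : EuclideanSpace ℝ (Fin n) →L[ℝ] EuclideanSpace ℝ (Fin n) :=
    LinearMap.toContinuousLinearMap ((W 0).projection _ hW0)
  have hpW : ∀ u, p u ∈ W 0 := fun u => Submodule.projection_apply_mem hW0 u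
  have hpF : ∀ u, ∃ a : ℝ, a • F x = u - p u := fun u => by
    have := Submodule.projection_apply_mem hW0.symm u
    rw [Submodule.projection_eq_self_sub_projection hW0] at this
    exact Submodule.mem_span_singleton.1 this
  -- boundedness of the inverse cocycle over one period
  obtain ⟨M, hM⟩ := (isCompact_Icc (a := (0 : ℝ)) (b := T)).exists_bound_of_continuousOn
    (f := fun t => fderiv ℝ (φ (-t)) (φ t x))
    ((continuous_fderiv_flow hφ2).comp (continuous_neg.prodMk (hφ2.continuous.comp
      (continuous_id.prodMk continuous_const)))).continuousOn
  have hM0 : 0 ≤ M := (norm_nonneg _).trans (hM 0 ⟨le_rfl, hT.le⟩)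
  set μ : ℝ := lam ^ T with hμ
  have hμ0 : 0 < μ := Real.rpow_pos_of_pos hlam0 T
  have hμ1 : μ < 1 := Real.rpow_lt_one hlam0.le hlam1 hT
  refine ⟨fun t => P t + H t, fun t => by simp only [H, hPper, hQ1per], fun t v => ?_,
    ‖G‖ * k * ((1 + ‖p‖ + C * ‖p‖) * M) ^ k + 1, μ, by positivity, hμ0, hμ1, fun N hN t ht => ?_⟩
  · convert! (hPode t v).add (hHode t v) using 1
    simp only [add_apply, Finset.sum_add_distrib]
    ring
  have hN1 : (1 : ℝ) ≤ N := by exact_mod_cast hN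
  have hNTpos : 0 < (N : ℝ) * T := by positivity
  have ht' : t ∈ Set.Icc (0 : ℝ) (N * T) := ⟨ht.1, ht.2.trans (le_mul_of_one_le_left hT.le hN1)⟩
  let Z : ℝ → ContinuousMultilinearMap ℝ (fun _ : Fin k => EuclideanSpace ℝ (Fin n)) ℝ :=
    fun s => AN N s - (P s + H s)
  have hZode : ∀ s ∈ Set.Icc (0 : ℝ) (N * T), ∀ v : Fin k → EuclideanSpace ℝ (Fin n),
      HasDerivWithinAt (fun r => Z r v)
        (-∑ j, Z s (Function.update v j (fderiv ℝ F (φ s x) (v j)))) (Set.Icc 0 (N * T)) s := by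
    intro s hs v
    convert! (hANode N hN s hs v).sub ((hPode s v).add (hHode s v)).hasDerivWithinAt using 1
    simp only [Z, add_apply, sub_apply,
      Finset.sum_add_distrib, Finset.sum_sub_distrib]
    ring
  have hZend : Z (N * T) = G := by simp only [Z, hANterm N hN, hPN, hHN, hG]
  refine (Z t).opNorm_le_bound (by positivity) fun v => ?_
  set u : Fin k → EuclideanSpace ℝ (Fin n) := fun i => fderiv ℝ (φ (-t)) (φ t x) (v i) with hu
  have hconst := apply_eq_of_homogeneous hNTpos hZode
    (m := fun i s => fderiv ℝ (φ s) x (u i))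
    fun i s => hasDerivAt_fderiv_flow hF1 hφ2 hφflow s x (u i)
  have hZv : Z t v = G fun i => fderiv ℝ (φ (N * T)) x (u i) := by
    rw [← hZend, hconst _ ⟨hNTpos.le, le_rfl⟩, ← hconst t ht']
    simp only [hu, fderiv_flow_fderiv_flow_neg hF1 hφ0 hφ2 hφflow]
  have hfix : fderiv ℝ (φ (N * T)) x (F x) = F x := by
    rw [fderiv_flow_vectorField hF1 hφ0 hφ2 hφflow, hNT]
  have hlamN : lam ^ ((N : ℝ) * T) = μ ^ N := by
    rw [mul_comm, Real.rpow_mul hlam0.le, Real.rpow_natCast]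
  have hstable : ∀ u, ‖fderiv ℝ (φ (N * T)) x (p u)‖ ≤ C * μ ^ N * ‖p u‖ := fun u => by
    have h := hcontr 0 (N * T) hNTpos.le (p u) (hpW u)
    rwa [hφ0, hlamN] at h
  have hest := norm_apply_le_of_contracting G hGF hpF hfix hC.le (by positivity)
    (pow_le_one₀ hμ0.le hμ1.le) hstable hM0 (v := v) (u := u)
    fun i => (ContinuousLinearMap.le_opNorm _ _).trans (by gcongr; exact hM t ht)
  rw [hZv]
  refine hest.trans ?_
  gcongr
  linarith
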